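/- arXiv:1304.0103 — 2 statements merged into one kernel-verified Lean document; each statement's English description precedes it below -/
import Mathlib

section
/- Let S ∈ TOEC. Then the set 𝒫 of measure polynomials of S, consisting of the measure polynomials P_B over all levels k ≥ 0 and all level-k blocks B of E_S, is finite. -/
open MeasureTheory Metric Set Pointwise

noncomputable section

/-- An iterated function system (IFS) of contracting similarities on `ℝ^d`. -/
structure IFS (d : ℕ) : Type 1 where
  ι : Type
  fin : Fintype ι
  f : ι → EuclideanSpace ℝ (Fin d) → EuclideanSpace ℝ (Fin d)
  r : ι → ℝ
  r_pos : ∀ i, 0 < r i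
  r_lt_one : ∀ i, r i < 1
  sim : ∀ i x y, dist (f i x) (f i y) = r i * dist x y

attribute [instance] IFS.fin

namespace IFS

variable {d : ℕ}

/-- `E` is the self-similar set (attractor) of `S`: the unique nonempty compact set
with `E = ⋃ i, S.f i '' E`. -/
def IsAttractor (S : IFS d) (E : Set (EuclideanSpace ℝ (Fin d))) : Prop :=
  E.Nonempty ∧ IsCompact E ∧ E = ⋃ i, S.f i '' E

open scoped Classical in
/-- The self-similar set generated by `S`. -/
def attractor (S : IFS d) : Set (EuclideanSpace ℝ (Fin d)) :=
  if h : ∃ E, S.IsAttractor E then h.choose else ∅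

/-- `O` is an open set witnessing the open set condition for `S`. -/
def OSCSet (S : IFS d) (O : Set (EuclideanSpace ℝ (Fin d))) : Prop :=
  O.Nonempty ∧ IsOpen O ∧ Bornology.IsBounded O ∧
    (∀ i, S.f i '' O ⊆ O) ∧ ∀ i j, i ≠ j → Disjoint (S.f i '' O) (S.f j '' O)

/-- The open set condition. -/
def OSC (S : IFS d) : Prop := ∃ O, S.OSCSet O

/-- The strong separation condition. -/
def SSC (S : IFS d) : Prop :=
  ∀ i j : S.ι, i ≠ j → Disjoint (S.f i '' S.attractor) (S.f j '' S.attractor)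

/-- `r` is the ratio root of `S`: the ratios are commensurable with common root `r`. -/
def IsRatioRoot (S : IFS d) (r : ℝ) : Prop :=
  0 < r ∧ r < 1 ∧
    ∃ lam : S.ι → ℕ, (∀ i, 0 < lam i) ∧ (∀ i, S.r i = r ^ lam i) ∧ Finset.univ.gcd lam = 1

/-- The Hausdorff dimension of the attractor of `S`, as a real number. -/
def hdim (S : IFS d) : ℝ := (dimH S.attractor).toReal

/-- Membership in the class TOEC: OSC, commensurable ratios, totally disconnected attractor. -/
def MemTOEC (S : IFS d) : Prop :=
  S.OSC ∧ (∃ r, S.IsRatioRoot r) ∧ IsTotallyDisconnected S.attractor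

/-- Membership in TOEC(p, r): measure root `p` and ratio root `r`. -/
def MemTOECpr (S : IFS d) (p r : ℝ) : Prop :=
  S.MemTOEC ∧ S.IsRatioRoot r ∧ p = r ^ S.hdim

/-- The natural measure of a set: normalized `s`-dimensional Hausdorff measure, `s = dimH E_S`. -/
def natMeasure (S : IFS d) (F : Set (EuclideanSpace ℝ (Fin d))) : ℝ :=
  (μH[S.hdim] F / μH[S.hdim] S.attractor).toReal

/-- `F` is an interior separated set of `E_S`. -/
def IsIntSep (S : IFS d) (F : Set (EuclideanSpace ℝ (Fin d))) : Prop :=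
  IsCompact F ∧ F ⊆ S.attractor ∧ IsCompact (S.attractor \ F) ∧ ∃ O, S.OSCSet O ∧ F ⊆ O

end IFS

/-- The subring `ℤ[p]` of `ℝ` generated by `ℤ` and `p`. -/
def Zring (p : ℝ) : Subring ℝ := Subring.closure {p}

/-- The underlying set of reals of an ideal of a subring of `ℝ`. -/
def idealSet {R : Subring ℝ} (I : Ideal R) : Set ℝ := (fun x : R => (x : ℝ)) '' (I : Set R)

/-- The ideal `I_S` of `ℤ[p]` generated by the natural measures of interior separated sets. -/
def IFS.idealOf {d : ℕ} (S : IFS d) (p : ℝ) : Ideal (Zring p) :=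
  Ideal.span {x : Zring p | ∃ F, S.IsIntSep F ∧ (x : ℝ) = S.natMeasure F}

/-- Two ideals of a subring `R` of `ℝ` lie in the same ideal class: `a·I = b·J`
for some nonzero `a, b ∈ R`. -/
def SameIdealClass {R : Subring ℝ} (I J : Ideal R) : Prop :=
  ∃ a b : R, a ≠ 0 ∧ b ≠ 0 ∧ (a : ℝ) • idealSet I = (b : ℝ) • idealSet J

/-- Lipschitz equivalence of subsets of (possibly different) metric spaces. -/
def LipEquiv {X Y : Type*} [MetricSpace X] [MetricSpace Y] (A : Set X) (B : Set Y) : Prop :=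
  ∃ (f : X → Y) (L : ℝ), 1 ≤ L ∧ Set.BijOn f A B ∧
    ∀ x ∈ A, ∀ y ∈ A, L⁻¹ * dist x y ≤ dist (f x) (f y) ∧ dist (f x) (f y) ≤ L * dist x y

/-- The composition `S_w = S_{i_1} ∘ ⋯ ∘ S_{i_n}` along a finite word `w = i_1 … i_n`. -/
def IFS.compWord {d : ℕ} (S : IFS d) (w : List S.ι) :
    EuclideanSpace ℝ (Fin d) → EuclideanSpace ℝ (Fin d) :=
  w.foldr (fun i g => S.f i ∘ g) id

/-- The contraction ratio `r_w = r_{i_1} ⋯ r_{i_n}` of the word `w`. -/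
def IFS.ratioProd {d : ℕ} (S : IFS d) (w : List S.ι) : ℝ := (w.map S.r).prod

/-- The word `w` belongs to the level-`k` family `S_k`: `r_w ≤ r^k < r_{w^-}`. -/
def IFS.InLevel {d : ℕ} (S : IFS d) (r : ℝ) (k : ℕ) (w : List S.ι) : Prop :=
  w ≠ [] ∧ S.ratioProd w ≤ r ^ k ∧ r ^ k < S.ratioProd w.dropLast

/-- `𝔅` is a level-`k` blocks decomposition of `E_S`: the members of `𝔅` are nonempty,
cover `E_S`, each set `{x : dist(x, B) < r^k|E|/2}` is connected, and distinct members
are at distance at least `r^k|E|`. -/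
def IFS.IsBlockDecomp {d : ℕ} (S : IFS d) (r : ℝ) (k : ℕ)
    (𝔅 : Set (Set (EuclideanSpace ℝ (Fin d)))) : Prop :=
  ⋃₀ 𝔅 = S.attractor ∧ (∀ B ∈ 𝔅, B.Nonempty) ∧
  (∀ B ∈ 𝔅, IsConnected {x | Metric.infDist x B < r ^ k * Metric.diam S.attractor / 2}) ∧
  ∀ B ∈ 𝔅, ∀ B' ∈ 𝔅, B ≠ B' →
    ∀ x ∈ B, ∀ y ∈ B', r ^ k * Metric.diam S.attractor ≤ dist x y

section Chains

variable {X Y : Type*} [MetricSpace X] [MetricSpace Y]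

/-- One step of a `δ`-chain in `A`. -/
def ChainStep (A : Set X) (δ : ℝ) (a b : X) : Prop := a ∈ A ∧ b ∈ A ∧ dist a b ≤ δ

/-- The endpoints of every `δ`-chain in `A` are at distance at most `D`. -/
def ChainBound (A : Set X) (δ D : ℝ) : Prop :=
  ∀ x y, Relation.ReflTransGen (ChainStep A δ) x y → dist x y ≤ D

lemma ChainBound.nonneg {A : Set X} {δ D : ℝ} (h : ChainBound A δ D) (x : X) : 0 ≤ D := by
  simpa using h x x .refl

lemma ChainBound.mono {A A' : Set X} {δ δ' D D' : ℝ} (h : ChainBound A δ D) (hA : A' ⊆ A)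
    (hδ : δ' ≤ δ) (hD : D ≤ D') : ChainBound A' δ' D' := fun x y hxy =>
  (h x y (Relation.ReflTransGen.mono
    (fun _ _ hab => ⟨hA hab.1, hA hab.2.1, hab.2.2.trans hδ⟩) _ _ hxy)).trans hD

lemma ChainBound.union {A B : Set X} {δ a b : ℝ} (hA : ChainBound A (b + 2 * δ) a)
    (hB : ChainBound B δ b) (hδ : 0 ≤ δ) : ChainBound (A ∪ B) δ (a + 2 * (b + δ)) := by
  intro x y hxy
  have ha := hA.nonneg x
  have hb := hB.nonneg x
  rcases hxy.cases_head with rfl | ⟨c, hxc, -⟩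
  · rw [dist_self]; positivity
  have hx : x ∈ A ∪ B := hxc.1
  have key : (x ∈ B ∧ y ∈ B ∧ Relation.ReflTransGen (ChainStep B δ) x y) ∨
      ∃ p q, dist x p ≤ b + δ ∧ q ∈ A ∧ Relation.ReflTransGen (ChainStep A (b + 2 * δ)) p q ∧
        (y = q ∨ ∃ s ∈ B, dist q s ≤ δ ∧ y ∈ B ∧
          Relation.ReflTransGen (ChainStep B δ) s y) := by
    clear hxc c
    induction hxy with
    | refl =>
      rcases hx with hx | hx
      · exact .inr ⟨x, x, by simpa using add_nonneg hb hδ, hx, .refl, .inl rfl⟩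
      · exact .inl ⟨hx, hx, .refl⟩
    | @tail y z _ hyz ih =>
      obtain ⟨-, hz, hd⟩ := hyz
      rcases ih with ⟨hxB, hyB, hc⟩ | ⟨p, q, hp, hq, hpq, rfl | ⟨s, hs, hqs, hyB, hsy⟩⟩
      · rcases hz with hz | hz
        · refine .inr ⟨z, z, ?_, hz, .refl, .inl rfl⟩
          linarith [dist_triangle x y z, hB x y hc]
        · exact .inl ⟨hxB, hz, hc.tail ⟨hyB, hz, hd⟩⟩
      · rcases hz with hz | hz
        · exact .inr ⟨p, z, hp, hz, hpq.tail ⟨hq, hz, by linarith⟩, .inl rfl⟩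
        · exact .inr ⟨p, y, hp, hq, hpq, .inr ⟨z, hz, hd, hz, .refl⟩⟩
      · rcases hz with hz | hz
        · refine .inr ⟨p, z, hp, hz, hpq.tail ⟨hq, hz, ?_⟩, .inl rfl⟩
          linarith [dist_triangle4 q s y z, hB s y hsy]
        · exact .inr ⟨p, q, hp, hq, hpq, .inr ⟨s, hs, hqs, hz, hsy.tail ⟨hyB, hz, hd⟩⟩⟩
  rcases key with ⟨-, -, hc⟩ | ⟨p, q, hp, -, hpq, rfl | ⟨s, -, hqs, -, hsy⟩⟩
  · linarith [hB x y hc]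
  · linarith [dist_triangle x p y, hA p y hpq]
  · linarith [dist_triangle4 x p q s, dist_triangle x s y, hA p q hpq, hB s y hsy]

lemma ChainBound.empty (δ : ℝ) {D : ℝ} (hD : 0 ≤ D) : ChainBound (∅ : Set X) δ D := by
  intro x y hxy
  rcases hxy.cases_head with rfl | ⟨c, hxc, -⟩
  · simpa using hD
  · exact hxc.1.elim

lemma ChainBound.image {A : Set X} {δ D ρ : ℝ} {g : X → Y} (h : ChainBound A δ D) (hρ : 0 < ρ)
    (hD : 0 ≤ D) (hg : ∀ x y, dist (g x) (g y) = ρ * dist x y) :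
    ChainBound (g '' A) (ρ * δ) (ρ * D) := by
  intro x y hxy
  rcases hxy.cases_head with rfl | ⟨c, ⟨⟨x', hx', rfl⟩, -⟩, -⟩
  · rw [dist_self]; positivity
  suffices ∃ y' ∈ A, g y' = y ∧ Relation.ReflTransGen (ChainStep A δ) x' y' by
    obtain ⟨y', -, rfl, hc⟩ := this
    rw [hg]
    exact mul_le_mul_of_nonneg_left (h _ _ hc) hρ.le
  induction hxy with
  | refl => exact ⟨x', hx', rfl, .refl⟩
  | tail _ hyz ih =>
    obtain ⟨y', hy', rfl, hc⟩ := ih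
    obtain ⟨-, ⟨z', hz', rfl⟩, hd⟩ := hyz
    rw [hg] at hd
    exact ⟨z', hz', rfl, hc.tail ⟨hy', hz', le_of_mul_le_mul_left hd hρ⟩⟩

lemma exists_chainBound_of_isTotallyDisconnected {E : Set X} (hE : IsCompact E)
    (hd : IsTotallyDisconnected E) {ε : ℝ} (hε : 0 < ε) : ∃ δ > 0, ChainBound E δ ε := by
  have : CompactSpace E := isCompact_iff_compactSpace.mp hE
  have : TotallyDisconnectedSpace E :=
    ⟨Topology.IsEmbedding.subtypeVal.isTotallyDisconnected (by simpa using hd)⟩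
  have key : ∃ δ > 0, ∀ x ∈ (univ : Set E), ∀ y,
      Relation.ReflTransGen (ChainStep E δ) (x : X) y → dist (x : X) y ≤ ε := by
    refine isCompact_univ.induction_on (p := fun s : Set E => ∃ δ > 0, ∀ x ∈ s, ∀ y,
      Relation.ReflTransGen (ChainStep E δ) (x : X) y → dist (x : X) y ≤ ε) ?_ ?_ ?_ ?_
    · exact ⟨1, one_pos, by simp⟩
    · rintro s t hst ⟨δ, hδ, h⟩
      exact ⟨δ, hδ, fun x hx => h x (hst hx)⟩
    · rintro s t ⟨δ, hδ, h⟩ ⟨δ', hδ', h'⟩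
      refine ⟨min δ δ', lt_min hδ hδ', ?_⟩
      rintro x (hx | hx) y hxy
      · exact h x hx y (Relation.ReflTransGen.mono
          (fun _ _ hab => ⟨hab.1, hab.2.1, hab.2.2.trans (min_le_left _ _)⟩) _ _ hxy)
      · exact h' x hx y
          (Relation.ReflTransGen.mono
          (fun _ _ hab => ⟨hab.1, hab.2.1, hab.2.2.trans (min_le_right _ _)⟩) _ _ hxy)
    · intro x _
      obtain ⟨V, hV, hxV, hVb⟩ := compact_exists_isClopen_in_isOpen
        (isOpen_ball (x := x) (ε := ε / 2)) (mem_ball_self (half_pos hε))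
      obtain ⟨δ, hδ, hth⟩ := hV.isClosed.isCompact.exists_thickening_subset_open hV.isOpen
        subset_rfl
      refine ⟨V, mem_nhdsWithin_of_mem_nhds (hV.isOpen.mem_nhds hxV), δ / 2, half_pos hδ, ?_⟩
      intro a ha y hay
      suffices ∃ b ∈ V, (b : X) = y by
        obtain ⟨b, hb, rfl⟩ := this
        have h1 := mem_ball.mp (hVb ha)
        have h2 := mem_ball'.mp (hVb hb)
        have := dist_triangle a x b
        rw [← Subtype.dist_eq]
        linarith
      induction hay with
      | refl => exact ⟨a, ha, rfl⟩
      | tail _ hyz ih =>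
        obtain ⟨b, hb, rfl⟩ := ih
        obtain ⟨-, hz, hd⟩ := hyz
        refine ⟨⟨_, hz⟩, hth (mem_thickening_iff.mpr ⟨b, hb, ?_⟩), rfl⟩
        rw [dist_comm, Subtype.dist_eq]
        exact hd.trans_lt (half_lt_self hδ)
  obtain ⟨δ, hδ, h⟩ := key
  refine ⟨δ, hδ, fun x y hxy => ?_⟩
  rcases hxy.cases_head with rfl | ⟨c, hxc, -⟩
  · simpa using hε.le
  · exact h ⟨x, hxc.1⟩ (mem_univ _) y hxy

/-- If the sets in a class with a notion of size satisfy a scale-invariant chain bound, then so do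
the unions of boundedly many of them. -/
lemma exists_chainBound_biUnion {α : Type*} (F : α → Set X) (Q : α → ℝ → Prop)
    (hQ : ∀ ε > 0, ∃ δ > 0, ∀ w t, 0 < t → Q w t → ChainBound (F w) (δ * t) (ε * t)) (M : ℕ) :
    ∀ ε > 0, ∃ δ > 0, ∀ t > 0, ∀ W : Finset α, W.card ≤ M → (∀ w ∈ W, Q w t) →
      ChainBound (⋃ w ∈ W, F w) (δ * t) (ε * t) := by
  classical
  induction M with
  | zero =>
    intro ε hε
    refine ⟨1, one_pos, fun t ht W hW _ => ?_⟩
    obtain rfl : W = ∅ := by simpa using hW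
    simpa using ChainBound.empty _ (by positivity)
  | succ M ih =>
    intro ε hε
    obtain ⟨δ₁, hδ₁, h₁⟩ := hQ (ε / 2) (half_pos hε)
    obtain ⟨δ₂, hδ₂, h₂⟩ := ih (min (δ₁ / 2) (ε / 8)) (by positivity)
    refine ⟨min δ₂ (min (δ₁ / 4) (ε / 8)), by positivity, fun t ht W hW hWQ => ?_⟩
    have i1 := min_le_left δ₂ (min (δ₁ / 4) (ε / 8))
    have i2 := (min_le_right δ₂ (min (δ₁ / 4) (ε / 8))).trans (min_le_left _ _)
    have i3 := (min_le_right δ₂ (min (δ₁ / 4) (ε / 8))).trans (min_le_right _ _)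
    have i4 := min_le_left (δ₁ / 2) (ε / 8)
    have i5 := min_le_right (δ₁ / 2) (ε / 8)
    have hδ : 0 < min δ₂ (min (δ₁ / 4) (ε / 8)) := by positivity
    generalize min δ₂ (min (δ₁ / 4) (ε / 8)) = δ at *
    generalize min (δ₁ / 2) (ε / 8) = η at *
    rcases W.eq_empty_or_nonempty with rfl | ⟨w, hw⟩
    · simpa using ChainBound.empty _ (by positivity)
    rw [← Finset.insert_erase hw, Finset.set_biUnion_insert]
    have hB : ChainBound (⋃ v ∈ W.erase w, F v) (δ * t) (η * t) :=
      (h₂ t ht (W.erase w) (by rw [Finset.card_erase_of_mem hw]; omega)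
        fun v hv => hWQ v (Finset.mem_of_mem_erase hv)).mono subset_rfl
        (mul_le_mul_of_nonneg_right i1 ht.le) le_rfl
    have hA : ChainBound (F w) (η * t + 2 * (δ * t)) (ε / 2 * t) :=
      (h₁ w t ht (hWQ w hw)).mono subset_rfl (by nlinarith) le_rfl
    exact (hA.union hB (by positivity)).mono subset_rfl le_rfl (by nlinarith)

/-- If a neighbourhood of `B` of radius `h / 2` is connected, any two points of `B` are joined by
an `h`-chain in `B`. -/
lemma reflTransGen_chainStep_of_isPreconnected {B : Set X} {h : ℝ} (hh : 0 < h)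
    (hB : IsPreconnected {x | infDist x B < h / 2}) {x y : X} (hx : x ∈ B) (hy : y ∈ B) :
    Relation.ReflTransGen (ChainStep B h) x y := by
  by_contra hxy
  set C := {z ∈ B | Relation.ReflTransGen (ChainStep B h) x z}
  have hxC : x ∈ C := ⟨hx, .refl⟩
  have hyC : y ∈ B \ C := ⟨hy, fun hy' => hxy hy'.2⟩
  have hlt : ∀ {A : Set X} {a : X}, a ∈ A → infDist a A < h / 2 := fun ha => by
    rw [infDist_zero_of_mem ha]; exact half_pos hh
  have hopen : ∀ A : Set X, IsOpen {u | infDist u A < h / 2} := fun A =>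
    isOpen_lt (continuous_infDist_pt A) continuous_const
  obtain ⟨u, -, hu, hu'⟩ := hB {u | infDist u C < h / 2} {u | infDist u (B \ C) < h / 2}
    (hopen _) (hopen _)
    (fun u hu => by
      obtain ⟨b, hb, hub⟩ := (infDist_lt_iff ⟨x, hx⟩).mp hu
      by_cases hbC : b ∈ C
      · exact .inl ((infDist_lt_iff ⟨x, hxC⟩).mpr ⟨b, hbC, hub⟩)
      · exact .inr ((infDist_lt_iff ⟨y, hyC⟩).mpr ⟨b, ⟨hb, hbC⟩, hub⟩))
    ⟨x, hlt hx, hlt hxC⟩ ⟨y, hlt hy, hlt hyC⟩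
  obtain ⟨a, ha, hua⟩ := (infDist_lt_iff ⟨x, hxC⟩).mp hu
  obtain ⟨b, hb, hub⟩ := (infDist_lt_iff ⟨y, hyC⟩).mp hu'
  refine hb.2 ⟨hb.1, ha.2.tail ⟨ha.1, hb.1, ?_⟩⟩
  linarith [dist_triangle_left a b u]

/-- In a bounded set, the number of points with a given separation is bounded. -/
lemma exists_card_le_of_separated [ProperSpace X] (x : X) (R : ℝ) {c : ℝ} (hc : 0 < c) :
    ∃ M : ℕ, ∀ T : Finset X, (∀ p ∈ T, p ∈ closedBall x R) →
      (∀ p ∈ T, ∀ q ∈ T, p ≠ q → c ≤ dist p q) → T.card ≤ M := by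
  obtain ⟨t, -, ht, hcov⟩ := (isCompact_closedBall x R).finite_cover_balls (half_pos hc)
  refine ⟨ht.toFinset.card, fun T hT hsep => ?_⟩
  have : ∀ p ∈ T, ∃ z ∈ ht.toFinset, dist p z < c / 2 := fun p hp => by
    simpa using hcov (hT p hp)
  choose! φ hφ hφd using this
  refine Finset.card_le_card_of_injOn φ hφ fun p hp q hq hpq => ?_
  by_contra hne
  have h1 := hφd p hp
  have h2 := hφd q hq
  rw [← hpq] at h2
  linarith [hsep p hp q hq hne, dist_triangle_right p q (φ p)]

end Chains

namespace IFS

variable {d : ℕ} (S : IFS d)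

@[simp] lemma compWord_nil : S.compWord [] = id := rfl

@[simp] lemma compWord_cons (i : S.ι) (w : List S.ι) :
    S.compWord (i :: w) = S.f i ∘ S.compWord w := rfl

@[simp] lemma ratioProd_nil : S.ratioProd [] = 1 := rfl

@[simp] lemma ratioProd_cons (i : S.ι) (w : List S.ι) :
    S.ratioProd (i :: w) = S.r i * S.ratioProd w := by simp [ratioProd]

lemma compWord_append (v w : List S.ι) :
    S.compWord (v ++ w) = S.compWord v ∘ S.compWord w := by
  induction v with
  | nil => rfl
  | cons i v ih => simp [ih, Function.comp_assoc]

lemma ratioProd_append (v w : List S.ι) :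
    S.ratioProd (v ++ w) = S.ratioProd v * S.ratioProd w := by simp [ratioProd]

lemma ratioProd_pos (w : List S.ι) : 0 < S.ratioProd w := by
  induction w with
  | nil => simp
  | cons i w ih => simpa using mul_pos (S.r_pos i) ih

lemma ratioProd_le_one (w : List S.ι) : S.ratioProd w ≤ 1 := by
  induction w with
  | nil => simp
  | cons i w ih =>
    simpa using mul_le_one₀ (S.r_lt_one i).le (S.ratioProd_pos w).le ih

lemma dist_compWord (w : List S.ι) (x y : EuclideanSpace ℝ (Fin d)) :
    dist (S.compWord w x) (S.compWord w y) = S.ratioProd w * dist x y := by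
  induction w with
  | nil => simp
  | cons i w ih => simp [S.sim, ih, mul_assoc]

lemma f_injective (i : S.ι) : Function.Injective (S.f i) := fun x y h => by
  have := S.sim i x y
  rw [h, dist_self, eq_comm, mul_eq_zero] at this
  exact dist_eq_zero.mp (this.resolve_left (S.r_pos i).ne')

lemma f_surjective (i : S.ι) : Function.Surjective (S.f i) := by
  have hr := S.r_pos i
  have hg : Isometry fun x => (S.r i)⁻¹ • S.f i x := Isometry.of_dist_eq fun x y => by
    rw [dist_smul₀, S.sim, Real.norm_eq_abs, abs_of_pos (inv_pos.mpr hr),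
      inv_mul_cancel_left₀ hr.ne']
  intro y
  obtain ⟨x, hx⟩ :=
    (hg.affineIsometryOfStrictConvexSpace.toAffineIsometryEquiv rfl).surjective ((S.r i)⁻¹ • y)
  exact ⟨x, smul_right_injective _ (inv_ne_zero hr.ne') hx⟩

lemma compWord_surjective (w : List S.ι) : Function.Surjective (S.compWord w) := by
  induction w with
  | nil => exact Function.surjective_id
  | cons i w ih => exact (S.f_surjective i).comp ih

variable {S}

lemma OSCSet.compWord_image_subset {O : Set (EuclideanSpace ℝ (Fin d))} (hO : S.OSCSet O)
    (w : List S.ι) : S.compWord w '' O ⊆ O := by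
  induction w with
  | nil => simp
  | cons i w ih =>
    rw [compWord_cons, image_comp]
    exact (image_mono ih).trans (hO.2.2.2.1 i)

lemma OSCSet.disjoint_compWord_image {O : Set (EuclideanSpace ℝ (Fin d))} (hO : S.OSCSet O) :
    ∀ {v w : List S.ι}, ¬ v <+: w → ¬ w <+: v →
      Disjoint (S.compWord v '' O) (S.compWord w '' O)
  | [], w, h, _ => (h w.nil_prefix).elim
  | v, [], _, h => (h v.nil_prefix).elim
  | i :: v, j :: w, hvw, hwv => by
    rw [compWord_cons, compWord_cons, image_comp, image_comp]
    by_cases hij : i = j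
    · subst hij
      rw [List.prefix_cons_inj] at hvw hwv
      exact (disjoint_image_iff (S.f_injective i)).mpr (hO.disjoint_compWord_image hvw hwv)
    · exact (hO.2.2.2.2 i j hij).mono (image_mono (hO.compWord_image_subset v))
        (image_mono (hO.compWord_image_subset w))

lemma InLevel.eq_of_prefix {r : ℝ} {k : ℕ} {v w : List S.ι} (hv : S.InLevel r k v)
    (hw : S.InLevel r k w) (hvw : v <+: w) : v = w := by
  obtain ⟨u, rfl⟩ := hvw
  rcases u.eq_nil_or_concat with rfl | ⟨u, i, rfl⟩
  · simp
  · have h1 := hw.2.2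
    rw [List.concat_eq_append, ← List.append_assoc, List.dropLast_concat, ratioProd_append] at h1
    have := mul_le_of_le_one_right (S.ratioProd_pos v).le (S.ratioProd_le_one u)
    linarith [hv.2.1]

lemma IsRatioRoot.exists_pow_le {r : ℝ} (hr : S.IsRatioRoot r) :
    ∃ Λ : ℕ, ∀ i, r ^ Λ ≤ S.r i ∧ S.r i ≤ r := by
  obtain ⟨h0, h1, lam, hpos, hlam, -⟩ := hr
  refine ⟨∑ i, lam i, fun i => ?_⟩
  rw [hlam i]
  exact ⟨pow_le_pow_of_le_one h0.le h1.le
      (Finset.single_le_sum (fun _ _ => Nat.zero_le _) (Finset.mem_univ i)),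
    pow_le_of_le_one h0.le h1.le (hpos i).ne'⟩

lemma InLevel.mul_pow_lt {r : ℝ} {k Λ : ℕ} (hΛ : ∀ i, r ^ Λ ≤ S.r i) (hr : 0 < r)
    {w : List S.ι} (hw : S.InLevel r k w) : r ^ Λ * r ^ k < S.ratioProd w := by
  obtain ⟨hne, -, h⟩ := hw
  rw [← List.dropLast_append_getLast hne, ratioProd_append]
  simp only [ratioProd_cons, ratioProd_nil, mul_one]
  rw [mul_comm]
  exact mul_lt_mul h (hΛ _) (pow_pos hr _) (S.ratioProd_pos _).le

lemma isAttractor_attractor (h : S.attractor.Nonempty) : S.IsAttractor S.attractor := by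
  unfold attractor at h ⊢
  split_ifs at h ⊢ with hE
  · exact hE.choose_spec
  · exact (not_nonempty_empty h).elim

lemma compWord_image_attractor_subset (h : S.attractor.Nonempty) (w : List S.ι) :
    S.compWord w '' S.attractor ⊆ S.attractor := by
  induction w with
  | nil => simp
  | cons i w ih =>
    rw [compWord_cons, image_comp]
    refine (image_mono ih).trans ?_
    conv_rhs => rw [(isAttractor_attractor h).2.2]
    exact subset_iUnion (fun i => S.f i '' S.attractor) i

lemma exists_inLevel_mem {r : ℝ} (hr : S.IsRatioRoot r) {k : ℕ} (hk : k ≠ 0)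
    {x : EuclideanSpace ℝ (Fin d)} (hx : x ∈ S.attractor) :
    ∃ w, S.InLevel r k w ∧ x ∈ S.compWord w '' S.attractor := by
  obtain ⟨Λ, hΛ⟩ := hr.exists_pow_le
  obtain ⟨h0, h1, -⟩ := hr
  have hE : S.attractor.Nonempty := ⟨x, hx⟩
  have key : ∀ n, (∃ w, S.InLevel r k w ∧ x ∈ S.compWord w '' S.attractor) ∨
      ∃ w, r ^ k < S.ratioProd w ∧ S.ratioProd w ≤ r ^ n ∧
        x ∈ S.compWord w '' S.attractor := by
    intro n
    induction n with
    | zero => exact .inr ⟨[], by simpa using pow_lt_one₀ h0.le h1 hk, by simp, by simpa using hx⟩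
    | succ n ih =>
      rcases ih with ih | ⟨w, hkw, hwn, e, he, rfl⟩
      · exact .inl ih
      · rw [(isAttractor_attractor hE).2.2] at he
        obtain ⟨i, u, hu, rfl⟩ := mem_iUnion.mp he
        have hmem : S.compWord w (S.f i u) ∈ S.compWord (w ++ [i]) '' S.attractor :=
          ⟨u, hu, by rw [compWord_append]; rfl⟩
        rcases le_or_gt (S.ratioProd (w ++ [i])) (r ^ k) with hle | hlt
        · exact .inl ⟨w ++ [i], ⟨by simp, hle, by simpa using hkw⟩, hmem⟩
        · refine .inr ⟨w ++ [i], hlt, ?_, hmem⟩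
          rw [ratioProd_append, pow_succ]
          simpa using mul_le_mul hwn (hΛ i).2 (S.r_pos i).le (pow_pos h0 n).le
  rcases key k with h | ⟨w, hlt, hle, -⟩
  · exact h
  · exact (hlt.not_ge hle).elim

/-- Under the open set condition, boundedly many level-`k` pieces meet a ball of radius
comparable to `r ^ k`. -/
lemma exists_card_le_of_inLevel (hS : S.OSC) {r : ℝ} (hr : S.IsRatioRoot r)
    (hE : S.attractor.Nonempty) (R : ℝ) :
    ∃ M : ℕ, ∀ (k : ℕ) (x : EuclideanSpace ℝ (Fin d)) (W : Finset (List S.ι)),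
      (∀ w ∈ W, S.InLevel r k w ∧
        (S.compWord w '' S.attractor ∩ closedBall x (R * r ^ k)).Nonempty) → W.card ≤ M := by
  classical
  obtain ⟨Λ, hΛ⟩ := hr.exists_pow_le
  obtain ⟨O, hO⟩ := hS
  obtain ⟨h0, -⟩ := hr
  obtain ⟨x₀, hx₀⟩ := hO.1
  obtain ⟨ρ, hρ, hball⟩ := Metric.isOpen_iff.mp hO.2.1 x₀ hx₀
  obtain ⟨D, hD⟩ := (isAttractor_attractor hE).2.1.isBounded.subset_closedBall x₀
  obtain ⟨M, hM⟩ := exists_card_le_of_separated (0 : EuclideanSpace ℝ (Fin d)) (R + D)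
    (mul_pos (pow_pos h0 Λ) hρ)
  refine ⟨M, fun k x W hW => ?_⟩
  have hk := pow_pos h0 k
  set φ : List S.ι → EuclideanSpace ℝ (Fin d) := fun w => (r ^ k)⁻¹ • (S.compWord w x₀ - x)
    with hφ
  have hφd : ∀ v w, dist (φ v) (φ w) = (r ^ k)⁻¹ * dist (S.compWord v x₀) (S.compWord w x₀) :=
    fun v w => by
      rw [hφ, dist_smul₀, dist_sub_right, Real.norm_eq_abs, abs_of_pos (inv_pos.mpr hk)]
  have hsep : ∀ v ∈ W, ∀ w ∈ W, v ≠ w → r ^ Λ * ρ ≤ dist (φ v) (φ w) := by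
    intro v hv w hw hvw
    have hvL := (hW v hv).1
    have hwL := (hW w hw).1
    have hdisj := hO.disjoint_compWord_image (fun h => hvw (hvL.eq_of_prefix hwL h))
      (fun h => hvw (hwL.eq_of_prefix hvL h).symm)
    have hle : S.ratioProd v * ρ ≤ dist (S.compWord v x₀) (S.compWord w x₀) := by
      by_contra! hlt
      obtain ⟨z, hz⟩ := S.compWord_surjective v (S.compWord w x₀)
      rw [← hz, dist_compWord] at hlt
      have hzO : z ∈ O := hball (mem_ball'.mpr (lt_of_mul_lt_mul_left hlt (S.ratioProd_pos v).le))
      exact disjoint_left.mp hdisj ⟨z, hzO, hz⟩ ⟨x₀, hx₀, rfl⟩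
    rw [hφd, le_inv_mul_iff₀ hk]
    have := mul_le_mul_of_nonneg_right (hvL.mul_pow_lt (fun i => (hΛ i).1) h0).le hρ.le
    linarith
  have hinj : Set.InjOn φ W := fun v hv w hw h => by
    by_contra hne
    have := hsep v hv w hw hne
    rw [h, dist_self] at this
    exact (mul_pos (pow_pos h0 Λ) hρ).not_ge this
  rw [← Finset.card_image_of_injOn hinj]
  refine hM _ ?_ ?_
  · simp only [Finset.mem_image]
    rintro _ ⟨w, hw, rfl⟩
    obtain ⟨hwL, _, ⟨e, he, rfl⟩, hex⟩ := hW w hw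
    have h1 : dist (S.compWord w x₀) (S.compWord w e) ≤ r ^ k * D := by
      rw [dist_compWord]
      exact mul_le_mul hwL.2.1 (mem_closedBall'.mp (hD he)) dist_nonneg hk.le
    have h2 := mem_closedBall.mp hex
    rw [mem_closedBall, dist_zero_right, hφ, norm_smul, norm_inv, Real.norm_eq_abs,
      abs_of_pos hk, inv_mul_le_iff₀ hk, ← dist_eq_norm]
    linarith [dist_triangle (S.compWord w x₀) (S.compWord w e) x]
  · simp only [Finset.mem_image]
    rintro _ ⟨v, hv, rfl⟩ _ ⟨w, hw, rfl⟩ hne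
    exact hsep v hv w hw fun h => hne (h ▸ rfl)

lemma IsBlockDecomp.attractor_nonempty {r : ℝ} {k : ℕ}
    {𝔅 : Set (Set (EuclideanSpace ℝ (Fin d)))} (h𝔅 : S.IsBlockDecomp r k 𝔅)
    {B : Set (EuclideanSpace ℝ (Fin d))} (hB : B ∈ 𝔅) : S.attractor.Nonempty :=
  (h𝔅.2.1 B hB).mono (h𝔅.1 ▸ subset_sUnion_of_mem hB)

lemma IsBlockDecomp.diam_pos {r : ℝ} (hr : 0 < r) {k : ℕ}
    {𝔅 : Set (Set (EuclideanSpace ℝ (Fin d)))} (h𝔅 : S.IsBlockDecomp r k 𝔅)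
    {B : Set (EuclideanSpace ℝ (Fin d))} (hB : B ∈ 𝔅) : 0 < diam S.attractor := by
  obtain ⟨u, hu⟩ := (h𝔅.2.2.1 B hB).1
  have : 0 < r ^ k * diam S.attractor := by
    have := (infDist_nonneg (x := u) (s := B)).trans_lt hu
    linarith
  exact pos_of_mul_pos_right this (pow_pos hr k).le

/-- For a totally disconnected attractor, level-`k` blocks have diameter comparable to `r ^ k`. -/
lemma exists_dist_le_of_isBlockDecomp (hS : S.MemTOEC) {r : ℝ} (hr : S.IsRatioRoot r) :
    ∃ C : ℝ, ∀ (k : ℕ) (𝔅 : Set (Set (EuclideanSpace ℝ (Fin d)))), S.IsBlockDecomp r k 𝔅 →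
      ∀ B ∈ 𝔅, ∀ x ∈ B, ∀ y ∈ B, dist x y ≤ C * r ^ k := by
  classical
  rcases S.attractor.eq_empty_or_nonempty with hE | hE
  · refine ⟨0, fun k 𝔅 h𝔅 B hB => ?_⟩
    exact ((h𝔅.attractor_nonempty hB).ne_empty hE).elim
  obtain ⟨Λ, hΛ⟩ := hr.exists_pow_le
  have hr0 := hr.1
  have hr1 := hr.2.1
  have hcpt := (isAttractor_attractor hE).2.1
  obtain ⟨M, hM⟩ := exists_card_le_of_inLevel hS.1 hr hE 2
  obtain ⟨δ, hδ, hchain⟩ := exists_chainBound_biUnion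
    (fun w : List S.ι => S.compWord w '' S.attractor)
    (fun w t => r ^ Λ * t ≤ S.ratioProd w ∧ S.ratioProd w ≤ t) (fun ε hε => by
      obtain ⟨δ, hδ, h⟩ := exists_chainBound_of_isTotallyDisconnected hcpt hS.2.2 hε
      refine ⟨r ^ Λ * δ, by positivity, fun w t ht hw => ?_⟩
      exact (h.image (S.ratioProd_pos w) hε.le (S.dist_compWord w)).mono subset_rfl
        (by nlinarith [hw.1]) (by nlinarith [hw.2])) M 1 one_pos
  obtain ⟨j, hj⟩ : ∃ j : ℕ, r ^ j * diam S.attractor ≤ min δ 1 := by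
    have : Filter.Tendsto (fun j : ℕ => r ^ j * diam S.attractor) Filter.atTop (nhds 0) := by
      simpa using (tendsto_pow_atTop_nhds_zero_of_lt_one hr0.le hr1).mul_const (diam S.attractor)
    exact (this.eventually_le_const (by positivity : 0 < min δ 1)).exists
  refine ⟨max 1 (diam S.attractor) * (r ^ j)⁻¹, fun k 𝔅 h𝔅 B hB x hx y hy => ?_⟩
  have hBE : B ⊆ S.attractor := h𝔅.1 ▸ subset_sUnion_of_mem hB
  have hdpos := h𝔅.diam_pos hr0 hB
  have hpj := pow_pos hr0 j
  rcases le_or_gt k j with hkj | hkj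
  · calc dist x y ≤ diam S.attractor := dist_le_diam_of_mem hcpt.isBounded (hBE hx) (hBE hy)
      _ = diam S.attractor * (r ^ j)⁻¹ * r ^ j := by field_simp
      _ ≤ max 1 (diam S.attractor) * (r ^ j)⁻¹ * r ^ k := by
        refine mul_le_mul ?_ (pow_le_pow_of_le_one hr0.le hr1.le hkj) hpj.le (by positivity)
        exact mul_le_mul_of_nonneg_right (le_max_right _ _) (inv_pos.mpr hpj).le
  obtain ⟨m, rfl⟩ := Nat.exists_eq_add_of_lt hkj
  have hm : m + 1 ≠ 0 := by omega
  have hpk : r ^ (j + m + 1) = r ^ j * r ^ (m + 1) := by ring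
  have ht := pow_pos hr0 (m + 1)
  generalize m + 1 = n at *
  suffices dist x y ≤ r ^ n by
    rw [hpk, mul_assoc, inv_mul_cancel_left₀ hpj.ne']
    nlinarith [le_max_left 1 (diam S.attractor)]
  obtain ⟨W, hW⟩ : ∃ W : Finset (List S.ι), ∀ w, w ∈ W ↔ S.InLevel r n w ∧
      (S.compWord w '' S.attractor ∩ closedBall x (2 * r ^ n)).Nonempty := by
    have hfin : {w | S.InLevel r n w ∧
        (S.compWord w '' S.attractor ∩ closedBall x (2 * r ^ n)).Nonempty}.Finite := by
      by_contra hinf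
      obtain ⟨W, hW, hcard⟩ := Set.Infinite.exists_subset_card_eq hinf (M + 1)
      have := hM n x W fun w hw => hW hw
      omega
    exact ⟨hfin.toFinset, fun w => by simp⟩
  have hWb := hchain (r ^ n) ht W (hM n x W fun w hw => (hW w).mp hw) fun w hw =>
    ⟨(((hW w).mp hw).1.mul_pow_lt (fun i => (hΛ i).1) hr0).le, ((hW w).mp hw).1.2.1⟩
  have hcov : ∀ z ∈ B, dist x z ≤ 2 * r ^ n → z ∈ ⋃ w ∈ W, S.compWord w '' S.attractor := by
    intro z hz hxz
    obtain ⟨w, hw, hzw⟩ := exists_inLevel_mem hr hm (hBE hz)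
    exact mem_iUnion₂.mpr ⟨w, (hW w).mpr ⟨hw, z, hzw, mem_closedBall'.mpr hxz⟩, hzw⟩
  have hstep : r ^ (j + m + 1) * diam S.attractor ≤ min δ 1 * r ^ n := by
    rw [hpk]; nlinarith
  have hB' := reflTransGen_chainStep_of_isPreconnected (by positivity)
    (h𝔅.2.2.1 B hB).isPreconnected hx hy
  rw [one_mul] at hWb
  refine hWb x y ?_
  clear hy
  induction hB' with
  | refl => exact .refl
  | @tail y z _ hyz ih =>
    obtain ⟨hyB, hzB, hd⟩ := hyz
    have hxy := hWb x y ih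
    have h1 : min δ 1 * r ^ n ≤ 1 * r ^ n := mul_le_mul_of_nonneg_right (min_le_right _ _) ht.le
    have h2 : min δ 1 * r ^ n ≤ δ * r ^ n := mul_le_mul_of_nonneg_right (min_le_left _ _) ht.le
    exact ih.tail ⟨hcov y hyB (by linarith),
      hcov z hzB (by linarith [dist_triangle x y z]), by linarith⟩

end IFS

/-- **Proposition.** For `S ∈ TOEC` with ratio root `r`, the set of measure
polynomials is finite: here a measure polynomial of a level-`k` block `B` is
represented by its coefficient function `ℓ ↦ ξ_{B,ℓ}`, where `ξ_{B,ℓ}` is the number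
of maps `S_w` with `w ∈ S_k`, `S_w(E) ⊆ B`, and ratio `r_w = r^{k+ℓ}`. -/
theorem measurePolynomials_finite {d : ℕ} (S : IFS d) (hS : S.MemTOEC)
    (r : ℝ) (hr : S.IsRatioRoot r) :
    { P : ℕ → ℕ | ∃ (k : ℕ) (𝔅 : Set (Set (EuclideanSpace ℝ (Fin d))))
        (B : Set (EuclideanSpace ℝ (Fin d))), S.IsBlockDecomp r k 𝔅 ∧ B ∈ 𝔅 ∧
        ∀ ℓ : ℕ, P ℓ = Nat.card {w : List S.ι // S.InLevel r k w ∧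
          S.compWord w '' S.attractor ⊆ B ∧ S.ratioProd w = r ^ (k + ℓ)} }.Finite := by
  rcases S.attractor.eq_empty_or_nonempty with hE | hE
  · refine Set.finite_empty.subset ?_
    rintro P ⟨k, 𝔅, B, h𝔅, hB, -⟩
    exact ((h𝔅.attractor_nonempty hB).ne_empty hE).elim
  obtain ⟨Λ, hΛ⟩ := hr.exists_pow_le
  obtain ⟨C, hC⟩ := IFS.exists_dist_le_of_isBlockDecomp hS hr
  obtain ⟨M, hM⟩ := IFS.exists_card_le_of_inLevel hS.1 hr hE C
  refine (Set.finite_range fun (g : Fin Λ → Fin (M + 1)) (ℓ : ℕ) =>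
    if h : ℓ < Λ then (g ⟨ℓ, h⟩ : ℕ) else 0).subset ?_
  rintro P ⟨k, 𝔅, B, h𝔅, hB, hP⟩
  have hbound : ∀ ℓ, P ℓ ≤ M := by
    intro ℓ
    rw [hP]
    by_contra! hlt
    have hfin : {w | S.InLevel r k w ∧ S.compWord w '' S.attractor ⊆ B ∧
        S.ratioProd w = r ^ (k + ℓ)}.Finite := 
      Nat.finite_of_card_ne_zero (M.zero_le.trans_lt hlt).ne'
    obtain ⟨x, hx⟩ := h𝔅.2.1 B hB
    refine hlt.not_ge ((Nat.card_eq_card_finite_toFinset hfin).trans_le ?_)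
    refine hM k x _ fun w hw => ?_
    obtain ⟨hwL, hwB, -⟩ := hfin.mem_toFinset.mp hw
    obtain ⟨e, he⟩ := hE
    have hew : S.compWord w e ∈ S.compWord w '' S.attractor := mem_image_of_mem _ he
    exact ⟨hwL, _, hew, mem_closedBall.mpr (hC k 𝔅 h𝔅 B hB _ (hwB hew) x hx)⟩
  have hzero : ∀ ℓ, Λ ≤ ℓ → P ℓ = 0 := by
    intro ℓ hℓ
    rw [hP, Nat.card_eq_zero]
    refine .inl ⟨?_⟩
    rintro ⟨w, hwL, -, hw⟩
    have h1 := hwL.mul_pow_lt (fun i => (hΛ i).1) hr.1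
    rw [hw, ← pow_add] at h1
    exact h1.not_ge (pow_le_pow_of_le_one hr.1.le hr.2.1.le (by omega))
  refine ⟨fun ℓ => ⟨P ℓ, Nat.lt_succ_of_le (hbound ℓ)⟩, funext fun ℓ => ?_⟩
  by_cases h : ℓ < Λ
  · simp [h]
  · simp [h, hzero ℓ (not_lt.mp h)]

end
end

section
/- Let F and F' be nonempty compact subsets of metric spaces with diameters |F| > 0 and |F'| > 0, and suppose F and F' have the same (ϱ, ι)-cylinder structure for some ϱ ∈ (0,1) and ι ≥ 1. Then there is a bijection f : F → F' such that ϱ·ι^{−2}·d(x,y)/|F| ≤ d(f(x), f(y))/|F'| ≤ ϱ^{−1}·ι^2·d(x,y)/|F| for all x, y ∈ F. In particular, F and F' are Lipschitz equivalent. -/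
open Metric

noncomputable section

/-- `𝒞` is a `(ϱ, ι)`-cylinder structure on `F`: for each `k ≥ 1`, the family `𝒞 k` is
a partition of `F` into nonempty pairwise disjoint sets, `𝒞 (k+1)` refines `𝒞 k`,
cylinders in `𝒞 k` have relative diameter between `ι⁻¹ ϱ^k` and `ι ϱ^k`, and distinct
cylinders in `𝒞 k` are at relative distance at least `ι⁻¹ ϱ^k`. -/
def IsCylinderStructure {X : Type*} [MetricSpace X] (F : Set X) (ϱ ι : ℝ)
    (𝒞 : ℕ → Set (Set X)) : Prop :=
  ∀ k, 1 ≤ k →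
    ((∀ C ∈ 𝒞 k, C.Nonempty) ∧ ⋃₀ 𝒞 k = F ∧
      (∀ C₁ ∈ 𝒞 k, ∀ C₂ ∈ 𝒞 k, C₁ ≠ C₂ → Disjoint C₁ C₂)) ∧
    (∀ C ∈ 𝒞 (k + 1), ∃ C' ∈ 𝒞 k, C ⊆ C') ∧
    (∀ C ∈ 𝒞 k, ι⁻¹ * ϱ ^ k ≤ diam C / diam F ∧ diam C / diam F ≤ ι * ϱ ^ k) ∧
    (∀ C₁ ∈ 𝒞 k, ∀ C₂ ∈ 𝒞 k, C₁ ≠ C₂ →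
      ∀ x ∈ C₁, ∀ y ∈ C₂, ι⁻¹ * ϱ ^ k ≤ dist x y / diam F)

/-- `F` and `F'` have the same `(ϱ, ι)`-cylinder structure, witnessed by cylinder
families `𝒞`, `𝒞'` and a cylinder mapping `f̃` which maps each `𝒞 k` bijectively onto
`𝒞' k`, is injective on the union of the families, and preserves inclusions across
levels. -/
def SameCylinderStructure {X Y : Type*} [MetricSpace X] [MetricSpace Y]
    (F : Set X) (F' : Set Y) (ϱ ι : ℝ)
    (𝒞 : ℕ → Set (Set X)) (𝒞' : ℕ → Set (Set Y)) (ft : Set X → Set Y) : Prop :=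
  IsCylinderStructure F ϱ ι 𝒞 ∧ IsCylinderStructure F' ϱ ι 𝒞' ∧
  (∀ k, 1 ≤ k → Set.BijOn ft (𝒞 k) (𝒞' k)) ∧
  Set.InjOn ft {C | ∃ k, 1 ≤ k ∧ C ∈ 𝒞 k} ∧
  ∀ k₁ k₂, 1 ≤ k₁ → k₁ < k₂ → ∀ C₁ ∈ 𝒞 k₁, ∀ C₂ ∈ 𝒞 k₂, (ft C₂ ⊆ ft C₁ ↔ C₂ ⊆ C₁)

namespace IsCylinderStructure

variable {X Y : Type*} [MetricSpace X] [MetricSpace Y] {F : Set X} {F' : Set Y} {ϱ ι : ℝ}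
  {𝒞 : ℕ → Set (Set X)} {𝒞' : ℕ → Set (Set Y)} {k : ℕ}

theorem subset {C : Set X} (h : IsCylinderStructure F ϱ ι 𝒞) (hk : 1 ≤ k) (hC : C ∈ 𝒞 k) :
    C ⊆ F :=
  (h k hk).1.2.1 ▸ Set.subset_sUnion_of_mem hC

theorem exists_mem {x : X} (h : IsCylinderStructure F ϱ ι 𝒞) (hk : 1 ≤ k) (hx : x ∈ F) :
    ∃ C ∈ 𝒞 k, x ∈ C := by
  rwa [← (h k hk).1.2.1] at hx

theorem eq_of_mem {x : X} {C D : Set X} (h : IsCylinderStructure F ϱ ι 𝒞) (hk : 1 ≤ k)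
    (hC : C ∈ 𝒞 k) (hD : D ∈ 𝒞 k) (hxC : x ∈ C) (hxD : x ∈ D) : C = D := by
  by_contra hne
  exact Set.disjoint_left.1 ((h k hk).1.2.2 C hC D hD hne) hxC hxD

theorem subset_of_mem_succ {x : X} {C D : Set X} (h : IsCylinderStructure F ϱ ι 𝒞) (hk : 1 ≤ k)
    (hC : C ∈ 𝒞 k) (hD : D ∈ 𝒞 (k + 1)) (hxC : x ∈ C) (hxD : x ∈ D) : D ⊆ C := by
  obtain ⟨E, hE, hDE⟩ := (h k hk).2.1 D hD
  exact h.eq_of_mem hk hE hC (hDE hxD) hxC ▸ hDE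

theorem dist_div_diam_le {x y : X} {C : Set X} (h : IsCylinderStructure F ϱ ι 𝒞)
    (hF : IsCompact F) (hk : 1 ≤ k) (hC : C ∈ 𝒞 k) (hx : x ∈ C) (hy : y ∈ C) :
    dist x y / diam F ≤ ι * ϱ ^ k := by
  refine le_trans ?_ ((h k hk).2.2.1 C hC).2
  gcongr
  exact dist_le_diam_of_mem (hF.isBounded.subset (h.subset hk hC)) hx hy

theorem isClosed {C : Set X} (h : IsCylinderStructure F ϱ ι 𝒞) (hF : IsCompact F)
    (hFd : 0 < diam F) (hϱ : 0 < ϱ) (hι : 0 < ι) (hk : 1 ≤ k) (hC : C ∈ 𝒞 k) :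
    IsClosed C := by
  refine isClosed_of_closure_subset fun z hz => ?_
  obtain ⟨D, hD, hzD⟩ :=
    h.exists_mem hk (closure_minimal (h.subset hk hC) hF.isClosed hz)
  obtain ⟨w, hw, hzw⟩ := Metric.mem_closure_iff.1 hz (ι⁻¹ * ϱ ^ k * diam F) (by positivity)
  by_contra hzC
  have hne : D ≠ C := fun hDC => hzC (hDC ▸ hzD)
  have := (h k hk).2.2.2 D hD C hC hne z hzD w hw
  rw [le_div_iff₀ hFd] at this
  exact absurd hzw this.not_gt

/-- A decreasing sequence of cylinders has a common point. -/
theorem exists_mem_iInter {C : ℕ → Set X} (h : IsCylinderStructure F ϱ ι 𝒞) (hF : IsCompact F)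
    (hFd : 0 < diam F) (hϱ : 0 < ϱ) (hι : 0 < ι) (hC : ∀ n, C n ∈ 𝒞 (n + 1))
    (hanti : ∀ n, C (n + 1) ⊆ C n) : ∃ x ∈ F, ∀ n, x ∈ C n := by
  have hcl : ∀ n, IsClosed (C n) := fun n => h.isClosed hF hFd hϱ hι (by omega) (hC n)
  have hsub : ∀ n, C n ⊆ F := fun n => h.subset (by omega) (hC n)
  obtain ⟨x, hx⟩ := IsCompact.nonempty_iInter_of_sequence_nonempty_isCompact_isClosed C hanti
    (fun n => (h (n + 1) (by omega)).1.1 _ (hC n)) (hF.of_isClosed_subset (hcl 0) (hsub 0)) hcl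
  rw [Set.mem_iInter] at hx
  exact ⟨x, hsub 0 (hx 0), hx⟩

/-- If `y` and `y'` share a cylinder at every level where `x` and `x'` do, then the relative
distance of `y` and `y'` is controlled by that of `x` and `x'`. -/
theorem dist_div_diam_le_mul {x x' : X} {y y' : Y} (h : IsCylinderStructure F ϱ ι 𝒞)
    (h' : IsCylinderStructure F' ϱ ι 𝒞') (hF' : IsCompact F') (hF'd : 0 < diam F')
    (hϱ0 : 0 < ϱ) (hϱ1 : ϱ < 1) (hι : 1 ≤ ι)
    (hx : x ∈ F) (hx' : x' ∈ F) (hy : y ∈ F') (hy' : y' ∈ F')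
    (hshare : ∀ k, 1 ≤ k → (∃ C ∈ 𝒞 k, x ∈ C ∧ x' ∈ C) → ∃ D ∈ 𝒞' k, y ∈ D ∧ y' ∈ D) :
    dist y y' / diam F' ≤ ϱ⁻¹ * ι ^ 2 * (dist x x' / diam F) := by
  classical
  have hle : ∀ k, (1 ≤ k → ∃ C ∈ 𝒞 k, x ∈ C ∧ x' ∈ C) →
      dist y y' / diam F' ≤ ι * ϱ ^ k := by
    intro k hk
    rcases Nat.eq_zero_or_pos k with rfl | hpos
    · rw [pow_zero, mul_one]
      refine le_trans ?_ hι
      rw [div_le_one hF'd]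
      exact dist_le_diam_of_mem hF'.isBounded hy hy'
    · obtain ⟨D, hD, hyD, hyD'⟩ := hshare k hpos (hk hpos)
      exact h'.dist_div_diam_le hF' hpos hD hyD hyD'
  by_cases hsep : ∃ n, ¬ ∃ C ∈ 𝒞 (n + 1), x ∈ C ∧ x' ∈ C
  · obtain ⟨n, hn, hmin⟩ : ∃ n, (¬ ∃ C ∈ 𝒞 (n + 1), x ∈ C ∧ x' ∈ C) ∧
        ∀ m < n, ∃ C ∈ 𝒞 (m + 1), x ∈ C ∧ x' ∈ C :=
      ⟨Nat.find hsep, Nat.find_spec hsep, fun m hm => not_not.1 (Nat.find_min hsep hm)⟩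
    obtain ⟨C, hC, hxC⟩ := h.exists_mem (k := n + 1) (by omega) hx
    obtain ⟨C', hC', hxC'⟩ := h.exists_mem (k := n + 1) (by omega) hx'
    have hne : C ≠ C' := fun he => hn ⟨C, hC, hxC, he ▸ hxC'⟩
    have hlow := (h (n + 1) (by omega)).2.2.2 C hC C' hC' hne x hxC x' hxC'
    have hup := hle n fun hpos => by
      simpa [Nat.sub_add_cancel hpos] using hmin (n - 1) (by omega)
    calc dist y y' / diam F' ≤ ι * ϱ ^ n := hup
      _ = ϱ⁻¹ * ι ^ 2 * (ι⁻¹ * ϱ ^ (n + 1)) := by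
        have : ι ≠ 0 := by positivity
        field_simp
        rw [pow_succ]
      _ ≤ _ := by gcongr
  · push Not at hsep
    have hlim : Filter.Tendsto (fun n : ℕ => ι * ϱ ^ n) Filter.atTop (nhds 0) := by
      simpa using (tendsto_pow_atTop_nhds_zero_of_lt_one hϱ0.le hϱ1).const_mul ι
    refine (ge_of_tendsto' hlim fun n => hle n fun hpos => ?_).trans
      (mul_nonneg (by positivity) (div_nonneg dist_nonneg diam_nonneg))
    simpa [Nat.sub_add_cancel hpos] using hsep (n - 1)

end IsCylinderStructure

/-- A bijection that distorts relative distances by a bounded factor is a Lipschitz equivalence. -/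
theorem lipEquiv_of_dist_div_bounds {X Y : Type*} [MetricSpace X] [MetricSpace Y]
    {A : Set X} {B : Set Y} {f : X → Y} {a b K : ℝ} (ha : 0 < a) (hb : 0 < b) (hK : 1 ≤ K)
    (hf : Set.BijOn f A B)
    (hdist : ∀ x ∈ A, ∀ y ∈ A, K⁻¹ * (dist x y / a) ≤ dist (f x) (f y) / b ∧
      dist (f x) (f y) / b ≤ K * (dist x y / a)) : LipEquiv A B := by
  have hK0 : 0 < K := by positivity
  refine ⟨f, K * max 1 (max (b / a) (a / b)),
    one_le_mul_of_one_le_of_one_le hK (le_max_left _ _), hf, fun x hx y hy => ?_⟩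
  obtain ⟨hlow, hup⟩ := hdist x hx y hy
  have hmax : 0 < max 1 (max (b / a) (a / b)) := lt_of_lt_of_le one_pos (le_max_left _ _)
  constructor
  · calc (K * max 1 (max (b / a) (a / b)))⁻¹ * dist x y
        ≤ (K * (a / b))⁻¹ * dist x y := by
          gcongr
          exact (le_max_right _ _).trans (le_max_right _ _)
      _ = K⁻¹ * (dist x y / a) * b := by field_simp
      _ ≤ _ := (le_div_iff₀ hb).1 hlow
  · calc dist (f x) (f y) ≤ K * (dist x y / a) * b := (div_le_iff₀ hb).1 hup
      _ = K * (b / a) * dist x y := by field_simp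
      _ ≤ _ := by
        gcongr
        exact (le_max_left _ _).trans (le_max_right _ _)

/-- **Lemma.** If the nonempty compact sets `F` and `F'` (of positive diameter) have
the same `(ϱ, ι)`-cylinder structure, then there is a bijection `f : F → F'` with
`ϱ ι⁻² · d(x,y)/|F| ≤ d(f x, f y)/|F'| ≤ ϱ⁻¹ ι² · d(x,y)/|F|`; in particular `F ≃ F'`. -/
theorem lipEquiv_of_sameCylinderStructure {X Y : Type*} [MetricSpace X] [MetricSpace Y]
    (F : Set X) (F' : Set Y) (hF : IsCompact F) (hF' : IsCompact F')
    (hFne : F.Nonempty) (hF'ne : F'.Nonempty)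
    (hFd : 0 < diam F) (hF'd : 0 < diam F')
    (ϱ ι : ℝ) (hϱ0 : 0 < ϱ) (hϱ1 : ϱ < 1) (hι : 1 ≤ ι)
    (𝒞 : ℕ → Set (Set X)) (𝒞' : ℕ → Set (Set Y)) (ft : Set X → Set Y)
    (h : SameCylinderStructure F F' ϱ ι 𝒞 𝒞' ft) :
    (∃ f : X → Y, Set.BijOn f F F' ∧ ∀ x ∈ F, ∀ y ∈ F,
        ϱ * ι⁻¹ ^ 2 * (dist x y / diam F) ≤ dist (f x) (f y) / diam F' ∧
        dist (f x) (f y) / diam F' ≤ ϱ⁻¹ * ι ^ 2 * (dist x y / diam F)) ∧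
      LipEquiv F F' := by
  obtain ⟨hC, hC', hbij, -, hmono⟩ := h
  have hι0 : 0 < ι := by positivity
  have hK : (ϱ⁻¹ * ι ^ 2)⁻¹ = ϱ * ι⁻¹ ^ 2 := by simp [mul_comm]
  let R : X → Y → Prop := fun x y => ∀ n, ∃ C ∈ 𝒞 (n + 1), x ∈ C ∧ y ∈ ft C
  have hleft : ∀ x ∈ F, ∃ y ∈ F', R x y := by
    intro x hx
    choose C hCm hxC using fun n : ℕ => hC.exists_mem (k := n + 1) (by omega) hx
    obtain ⟨y, hy, hyC⟩ := hC'.exists_mem_iInter (C := fun n => ft (C n)) hF' hF'd hϱ0 hι0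
      (fun n => (hbij (n + 1) (by omega)).mapsTo (hCm n))
      (fun n => (hmono (n + 1) (n + 1 + 1) (by omega) (by omega) _ (hCm n) _ (hCm (n + 1))).2
        (hC.subset_of_mem_succ (by omega) (hCm n) (hCm (n + 1)) (hxC n) (hxC (n + 1))))
    exact ⟨y, hy, fun n => ⟨C n, hCm n, hxC n, hyC n⟩⟩
  have hright : ∀ y ∈ F', ∃ x ∈ F, R x y := by
    intro y hy
    have hex : ∀ n : ℕ, ∃ C ∈ 𝒞 (n + 1), y ∈ ft C := fun n => by
      obtain ⟨D, hD, hyD⟩ := hC'.exists_mem (k := n + 1) (by omega) hy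
      obtain ⟨C, hCm, rfl⟩ := (hbij (n + 1) (by omega)).surjOn hD
      exact ⟨C, hCm, hyD⟩
    choose C hCm hyC using hex
    have hDm : ∀ n, ft (C n) ∈ 𝒞' (n + 1) := fun n => (hbij (n + 1) (by omega)).mapsTo (hCm n)
    obtain ⟨x, hx, hxC⟩ := hC.exists_mem_iInter hF hFd hϱ0 hι0 hCm
      (fun n => (hmono (n + 1) (n + 1 + 1) (by omega) (by omega) _ (hCm n) _ (hCm (n + 1))).1
        (hC'.subset_of_mem_succ (by omega) (hDm n) (hDm (n + 1)) (hyC n) (hyC (n + 1))))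
    exact ⟨x, hx, fun n => ⟨C n, hCm n, hxC n, hyC n⟩⟩
  have hshare : ∀ {x x' y y'}, R x y → R x' y' → ∀ k, 1 ≤ k →
      ((∃ C ∈ 𝒞 k, x ∈ C ∧ x' ∈ C) ↔ ∃ D ∈ 𝒞' k, y ∈ D ∧ y' ∈ D) := by
    intro x x' y y' hxy hxy' k hk
    obtain ⟨n, rfl⟩ := Nat.exists_eq_add_of_le' hk
    obtain ⟨C, hCm, hxC, hyC⟩ := hxy n
    obtain ⟨C', hCm', hxC', hyC'⟩ := hxy' n
    have hb := hbij (n + 1) hk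
    constructor
    · rintro ⟨E, hE, hxE, hxE'⟩
      obtain rfl := hC.eq_of_mem hk hCm hE hxC hxE
      obtain rfl := hC.eq_of_mem hk hCm' hE hxC' hxE'
      exact ⟨_, hb.mapsTo hE, hyC, hyC'⟩
    · rintro ⟨D, hD, hyD, hyD'⟩
      have hCC' : C = C' := hb.injOn hCm hCm' <|
        (hC'.eq_of_mem hk (hb.mapsTo hCm) hD hyC hyD).trans
          (hC'.eq_of_mem hk (hb.mapsTo hCm') hD hyC' hyD').symm
      exact ⟨C, hCm, hxC, hCC' ▸ hxC'⟩
  have hup : ∀ {x x' y y'}, x ∈ F → x' ∈ F → y ∈ F' → y' ∈ F' → R x y → R x' y' →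
      dist y y' / diam F' ≤ ϱ⁻¹ * ι ^ 2 * (dist x x' / diam F) :=
    fun hx hx' hy hy' hxy hxy' => hC.dist_div_diam_le_mul hC' hF' hF'd hϱ0 hϱ1 hι hx hx' hy hy'
      fun k hk => (hshare hxy hxy' k hk).1
  have hdown : ∀ {x x' y y'}, x ∈ F → x' ∈ F → y ∈ F' → y' ∈ F' → R x y → R x' y' →
      dist x x' / diam F ≤ ϱ⁻¹ * ι ^ 2 * (dist y y' / diam F') :=
    fun hx hx' hy hy' hxy hxy' => hC'.dist_div_diam_le_mul hC hF hFd hϱ0 hϱ1 hι hy hy' hx hx'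
      fun k hk => (hshare hxy hxy' k hk).2
  have : Nonempty Y := hF'ne.to_type
  choose! f hfF hfR using hleft
  have hf : Set.BijOn f F F' := by
    refine ⟨hfF, fun x hx x' hx' he => ?_, fun y hy => ?_⟩
    · have hd := hdown hx hx' (hfF x hx) (hfF x' hx') (hfR x hx) (hfR x' hx')
      rw [he, dist_self, zero_div, mul_zero, div_le_iff₀ hFd, zero_mul] at hd
      exact dist_le_zero.1 hd
    · obtain ⟨x, hx, hxy⟩ := hright y hy
      have hd := hup hx hx (hfF x hx) hy (hfR x hx) hxy
      rw [dist_self, zero_div, mul_zero, div_le_iff₀ hF'd, zero_mul] at hd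
      exact ⟨x, hx, dist_le_zero.1 hd⟩
  have hbounds : ∀ x ∈ F, ∀ y ∈ F,
      (ϱ⁻¹ * ι ^ 2)⁻¹ * (dist x y / diam F) ≤ dist (f x) (f y) / diam F' ∧
      dist (f x) (f y) / diam F' ≤ ϱ⁻¹ * ι ^ 2 * (dist x y / diam F) := fun x hx y hy =>
    ⟨(inv_mul_le_iff₀ (by positivity)).2
      (hdown hx hy (hfF x hx) (hfF y hy) (hfR x hx) (hfR y hy)),
      hup hx hy (hfF x hx) (hfF y hy) (hfR x hx) (hfR y hy)⟩
  exact ⟨⟨f, hf, hK ▸ hbounds⟩, lipEquiv_of_dist_div_bounds hFd hF'd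
    (one_le_mul_of_one_le_of_one_le ((one_le_inv₀ hϱ0).2 hϱ1.le) (one_le_pow₀ hι)) hf hbounds⟩

end
end
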